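/- Let S be a finite planar point set in general position with |S| ≥ 3 and let u, v ∈ S be distinct. There exists a plane straight-line spanning path on S whose first two vertices are u and v (in this order) if and only if (i) u or v lies strictly in the interior of the convex hull of S, or (ii) u and v are consecutive vertices along the boundary of the convex hull of S. -/

import Mathlib

open scoped Classical

noncomputable section

abbrev Pt : Type := ℝ × ℝ

/-- default point -/
def pd : Pt := (0, 0)

/-- No three distinct points of `S` are collinear. -/
def GenPos (S : Finset Pt) : Prop :=
  ∀ p ∈ S, ∀ q ∈ S, ∀ r ∈ S, p ≠ q → p ≠ r → q ≠ r →
    ¬ Collinear ℝ ({p, q, r} : Set Pt)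

/-- The (ordered) edges of a path given as a list of vertices. -/
def pathEdges (l : List Pt) : List (Pt × Pt) := l.zip l.tail

/-- The (ordered) edges of a cycle given as a list of vertices. -/
def cycleEdges (l : List Pt) : List (Pt × Pt) := l.zip (l.rotate 1)

/-- A family of straight-line segments is pairwise non-crossing:
the open segments of any two distinct members are disjoint. -/
def NonCrossing (E : List (Pt × Pt)) : Prop :=
  E.Pairwise fun e f => openSegment ℝ e.1 e.2 ∩ openSegment ℝ f.1 f.2 = ∅

/-- `l` is a plane (crossing-free) straight-line spanning path of `S`. -/
def IsPlanePath (S : Finset Pt) (l : List Pt) : Prop :=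
  l.Nodup ∧ l.toFinset = S ∧ NonCrossing (pathEdges l)

/-- `l` is a plane straight-line spanning cycle of `S`. -/
def IsPlaneCycle (S : Finset Pt) (l : List Pt) : Prop :=
  3 ≤ l.length ∧ l.Nodup ∧ l.toFinset = S ∧ NonCrossing (cycleEdges l)

/-- The set of edges of a path, as unordered pairs. -/
def edgeSet (l : List Pt) : Finset (Sym2 Pt) :=
  ((pathEdges l).map fun e => s(e.1, e.2)).toFinset

/-- The set of edges of a cycle, as unordered pairs. -/
def cycleEdgeSet (l : List Pt) : Finset (Sym2 Pt) :=
  ((cycleEdges l).map fun e => s(e.1, e.2)).toFinset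

/-- No segment joining two points of `S` crosses any edge of the cycle `l`. -/
def UncrossedCycle (S : Finset Pt) (l : List Pt) : Prop :=
  ∀ a ∈ S, ∀ b ∈ S, a ≠ b → ∀ e ∈ cycleEdges l, s(a, b) ≠ s(e.1, e.2) →
    openSegment ℝ a b ∩ openSegment ℝ e.1 e.2 = ∅

/-- Two plane spanning paths of `S` differ by a single flip. -/
def FlipAdj (S : Finset Pt) (P Q : List Pt) : Prop :=
  IsPlanePath S P ∧ IsPlanePath S Q ∧
    ∃ e f, e ≠ f ∧ e ∈ edgeSet P ∧ f ∈ edgeSet Q ∧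
      (edgeSet P).erase e = (edgeSet Q).erase f

/-- There is a sequence of `k` flips from `P` to (a representative of) `Q`, all of whose
members are plane spanning paths of `S` satisfying the additional property `A`. -/
def FlipSeq (S : Finset Pt) (A : List Pt → Prop) (k : ℕ) (P Q : List Pt) : Prop :=
  ∃ f : ℕ → List Pt, f 0 = P ∧ edgeSet (f k) = edgeSet Q ∧
    (∀ i ≤ k, IsPlanePath S (f i) ∧ A (f i)) ∧
    ∀ i < k, FlipAdj S (f i) (f (i + 1))

/-- The flip graph on the plane spanning paths of `S` satisfying `A` is connected. -/
def FlipConnected (S : Finset Pt) (A : List Pt → Prop) : Prop :=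
  ∀ P Q : List Pt, IsPlanePath S P → A P → IsPlanePath S Q → A Q →
    ∃ k, FlipSeq S A k P Q

/-- `uv` is an edge of the boundary of the convex hull of `S`. -/
def HullEdge (S : Finset Pt) (u v : Pt) : Prop :=
  u ∈ S ∧ v ∈ S ∧ u ≠ v ∧ segment ℝ u v ⊆ frontier (convexHull ℝ (S : Set Pt))

/-- `p` is an extreme point (a vertex of the convex hull) of `S`. -/
def ExtremePt (S : Finset Pt) (p : Pt) : Prop :=
  p ∈ S ∧ p ∉ convexHull ℝ ((S.erase p : Finset Pt) : Set Pt)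

/-- `p` is a point of `S` lying strictly in the interior of the convex hull of `S`. -/
def InteriorPt (S : Finset Pt) (p : Pt) : Prop :=
  p ∈ S ∧ p ∈ interior (convexHull ℝ (S : Set Pt))

/-- Twice the signed area of the triangle `a b c` (orientation test). -/
def sign3 (a b c : Pt) : ℝ :=
  (b.1 - a.1) * (c.2 - a.2) - (b.2 - a.2) * (c.1 - a.1)

/-! ### Orientation and convex hulls -/

lemma sign3_ne_zero {S : Finset Pt} (hgp : GenPos S) {a b c : Pt} (ha : a ∈ S) (hb : b ∈ S)
    (hc : c ∈ S) (hab : a ≠ b) (hac : a ≠ c) (hbc : b ≠ c) : sign3 a b c ≠ 0 := by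
  intro h
  refine hgp a ha b hb c hc hab hac hbc ?_
  unfold sign3 at h
  rw [collinear_iff_of_mem (p₀ := a) (by simp)]
  by_cases h1 : b.1 - a.1 = 0
  · have h2 : b.2 - a.2 ≠ 0 := fun h2 => hab (Prod.ext (by linarith) (by linarith))
    have h3 : c.1 - a.1 = 0 := by
      rw [h1, zero_mul, zero_sub, neg_eq_zero] at h
      exact (mul_eq_zero.mp h).resolve_left h2
    refine ⟨b - a, ?_⟩
    rintro p (rfl | rfl | rfl)
    · exact ⟨0, by simp⟩
    · exact ⟨1, by simp⟩
    · refine ⟨(p.2 - a.2) / (b.2 - a.2), Prod.ext ?_ ?_⟩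
      · simp [h1]; linarith
      · simp; field_simp; ring
  · refine ⟨b - a, ?_⟩
    rintro p (rfl | rfl | rfl)
    · exact ⟨0, by simp⟩
    · exact ⟨1, by simp⟩
    · refine ⟨(p.1 - a.1) / (b.1 - a.1), Prod.ext ?_ ?_⟩
      · simp; field_simp; ring
      · simp; field_simp; linarith

lemma notMem_interior_of_sign3_nonneg {S : Finset Pt} {a b x : Pt} (hab : a ≠ b)
    (h : ∀ r ∈ S, 0 ≤ sign3 a b r) (hx : sign3 a b x = 0) :
    x ∉ interior (convexHull ℝ (S : Set Pt)) := by
  intro hi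
  have hsub : convexHull ℝ (S : Set Pt) ⊆ {y | 0 ≤ sign3 a b y} := by
    refine convexHull_min (fun r hr => h r hr) ?_
    intro y hy z hz s t hs ht hst
    simp only [Set.mem_ofPred_eq] at hy hz ⊢
    have : sign3 a b (s • y + t • z) = s * sign3 a b y + t * sign3 a b z := by
      obtain rfl : s = 1 - t := by linarith
      simp [sign3]; ring
    rw [this]; positivity
  have hc : Continuous fun t : ℝ => (x.1 + t * (b.2 - a.2), x.2 - t * (b.1 - a.1)) := by
    fun_prop
  have hev := hc.continuousAt.preimage_mem_nhds (x := 0)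
    (by simpa using isOpen_interior.mem_nhds hi)
  obtain ⟨ε, hε, hball⟩ := Metric.mem_nhds_iff.mp hev
  have hmem := hball (show ε / 2 ∈ Metric.ball (0 : ℝ) ε by
    rw [Metric.mem_ball, Real.dist_eq, sub_zero, abs_of_pos (by positivity)]; linarith)
  have h0 : 0 ≤ sign3 a b (x.1 + ε / 2 * (b.2 - a.2), x.2 - ε / 2 * (b.1 - a.1)) :=
    hsub hmem
  have hpos : 0 < (b.1 - a.1) ^ 2 + (b.2 - a.2) ^ 2 := by
    by_contra hn
    exact hab (Prod.ext (by nlinarith [sq_nonneg (b.1 - a.1), sq_nonneg (b.2 - a.2)])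
      (by nlinarith [sq_nonneg (b.1 - a.1), sq_nonneg (b.2 - a.2)]))
  have : sign3 a b (x.1 + ε / 2 * (b.2 - a.2), x.2 - ε / 2 * (b.1 - a.1))
      = sign3 a b x - ε / 2 * ((b.1 - a.1) ^ 2 + (b.2 - a.2) ^ 2) := by
    simp [sign3]; ring
  rw [this, hx] at h0
  nlinarith

lemma mem_interior_of_sign3_pos {S : Finset Pt} {a b c x : Pt} (ha : a ∈ S) (hb : b ∈ S)
    (hc : c ∈ S) (h1 : 0 < sign3 a b x) (h2 : 0 < sign3 b c x) (h3 : 0 < sign3 c a x) :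
    x ∈ interior (convexHull ℝ (S : Set Pt)) := by
  rw [mem_interior]
  refine ⟨{y | 0 < sign3 a b y} ∩ {y | 0 < sign3 b c y} ∩ {y | 0 < sign3 c a y}, ?_, ?_,
    ⟨⟨h1, h2⟩, h3⟩⟩
  · rintro y ⟨⟨h1, h2⟩, h3⟩
    simp only [Set.mem_ofPred_eq] at h1 h2 h3
    set d := sign3 a b y + sign3 b c y + sign3 c a y with hd
    have hd0 : 0 < d := by positivity
    have hy : y = (sign3 b c y / d) • a + (sign3 c a y / d) • b + (sign3 a b y / d) • c := by
      refine Prod.ext ?_ ?_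
      · simp; field_simp; rw [hd]; unfold sign3; ring
      · simp; field_simp; rw [hd]; unfold sign3; ring
    have hconv := convex_convexHull ℝ (S : Set Pt)
    have hm : ∀ {p}, p ∈ S → p ∈ convexHull ℝ (S : Set Pt) :=
      fun hp => subset_convexHull ℝ _ hp
    rw [hy]
    have := hconv.sum_mem (t := Finset.univ)
      (w := ![sign3 b c y / d, sign3 c a y / d, sign3 a b y / d]) (z := ![a, b, c])
      (by intro i _; fin_cases i <;> simp <;> positivity)
      (by simp [Fin.sum_univ_three]; field_simp; rw [hd]; ring)
      (by intro i _; fin_cases i <;> simp [hm, ha, hb, hc])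
    simpa [Fin.sum_univ_three] using this
  · have : ∀ p q : Pt, IsOpen {y | 0 < sign3 p q y} := fun p q =>
      isOpen_lt continuous_const (by unfold sign3; fun_prop)
    exact ((this a b).inter (this b c)).inter (this c a)

lemma sign3_convexComb_right (a b p q : Pt) {s t : ℝ} (hst : s + t = 1) :
    sign3 a b (s • p + t • q) = s * sign3 a b p + t * sign3 a b q := by
  obtain rfl : s = 1 - t := by linarith
  simp [sign3]; ring

lemma mem_interior_of_crossing {S : Finset Pt} {u v a b : Pt} (hu : u ∈ S) (hv : v ∈ S)
    (ha : a ∈ S) (hb : b ∈ S) (h1 : 0 < sign3 u v a) (h2 : sign3 u v b < 0) {s t : ℝ}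
    (hs : 0 < s) (ht : 0 < t) (hst : s + t = 1) (hne : sign3 a b (s • u + t • v) ≠ 0) :
    s • u + t • v ∈ interior (convexHull ℝ (S : Set Pt)) := by
  have e1 : sign3 b v (s • u + t • v) = - (s * sign3 u v b) := by
    obtain rfl : s = 1 - t := by linarith
    simp [sign3]; ring
  have e2 : sign3 v a (s • u + t • v) = s * sign3 u v a := by
    obtain rfl : s = 1 - t := by linarith
    simp [sign3]; ring
  have e3 : sign3 a u (s • u + t • v) = t * sign3 u v a := by
    obtain rfl : s = 1 - t := by linarith
    simp [sign3]; ring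
  have e4 : sign3 u b (s • u + t • v) = - (t * sign3 u v b) := by
    obtain rfl : s = 1 - t := by linarith
    simp [sign3]; ring
  have e5 : sign3 b a (s • u + t • v) = - sign3 a b (s • u + t • v) := by
    simp [sign3]; ring
  rcases lt_or_gt_of_ne hne with h | h
  · refine mem_interior_of_sign3_pos hb ha hu (by rw [e5]; linarith) (by rw [e3]; positivity) ?_
    rw [e4]; nlinarith
  · refine mem_interior_of_sign3_pos ha hb hv h (by rw [e1]; nlinarith) (by rw [e2]; positivity)

lemma HullEdge.not_separates {S : Finset Pt} (hgp : GenPos S) {u v a b : Pt}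
    (h : HullEdge S u v) (ha : a ∈ S) (hb : b ∈ S) (h1 : 0 < sign3 u v a)
    (h2 : sign3 u v b < 0) : False := by
  obtain ⟨hu, hv, huv, hseg⟩ := h
  have hau : a ≠ u := by rintro rfl; simp [sign3] at h1
  have hbu : b ≠ u := by rintro rfl; simp [sign3] at h2
  have hab : a ≠ b := by rintro rfl; linarith
  have hn := sign3_ne_zero hgp ha hb hu hab hau hbu
  have key : ∀ s t : ℝ, 0 < s → 0 < t → s + t = 1 →
      s * sign3 a b u + t * sign3 a b v = 0 := by
    intro s t hs ht hst
    rw [← sign3_convexComb_right _ _ _ _ hst]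
    by_contra hne
    exact (hseg ⟨s, t, hs.le, ht.le, hst, rfl⟩).2
      (mem_interior_of_crossing hu hv ha hb h1 h2 hs ht hst hne)
  have k1 := key (1 / 2) (1 / 2) (by norm_num) (by norm_num) (by norm_num)
  have k2 := key (2 / 3) (1 / 3) (by norm_num) (by norm_num) (by norm_num)
  exact hn (by linarith)

lemma hullEdge_of_sign3_nonneg {S : Finset Pt} {u v a b : Pt} (hu : u ∈ S) (hv : v ∈ S)
    (huv : u ≠ v) (hab : a ≠ b) (h : ∀ r ∈ S, 0 ≤ sign3 a b r) (hau : sign3 a b u = 0)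
    (hav : sign3 a b v = 0) : HullEdge S u v := by
  refine ⟨hu, hv, huv, ?_⟩
  rintro x hx
  refine ⟨subset_closure ((convex_convexHull ℝ (S : Set Pt)).segment_subset
    (subset_convexHull ℝ _ hu) (subset_convexHull ℝ _ hv) hx), ?_⟩
  obtain ⟨s, t, hs, ht, hst, rfl⟩ := hx
  refine notMem_interior_of_sign3_nonneg hab h ?_
  rw [sign3_convexComb_right _ _ _ _ hst, hau, hav]
  simp

/-- If the line through `u` and `v` separates `a` from `b` and the segments `uv` and `ab`
do not cross, then `u` or `v` lies in the interior of the hull. -/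
lemma mem_interior_or_of_separates {S : Finset Pt} (hgp : GenPos S) {u v a b : Pt}
    (hu : u ∈ S) (hv : v ∈ S) (ha : a ∈ S) (hb : b ∈ S) (h1 : 0 < sign3 u v a)
    (h2 : sign3 u v b < 0) (hd : openSegment ℝ u v ∩ openSegment ℝ a b = ∅) :
    u ∈ interior (convexHull ℝ (S : Set Pt)) ∨ v ∈ interior (convexHull ℝ (S : Set Pt)) := by
  have hau : a ≠ u := by rintro rfl; simp [sign3] at h1
  have hbu : b ≠ u := by rintro rfl; simp [sign3] at h2
  have hav : a ≠ v := by rintro rfl; simp [sign3] at h1; linarith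
  have hbv : b ≠ v := by rintro rfl; simp [sign3] at h2; linarith
  have hab : a ≠ b := by rintro rfl; linarith
  have hnu := sign3_ne_zero hgp ha hb hu hab hau hbu
  have hnv := sign3_ne_zero hgp ha hb hv hab hav hbv
  have e1 : sign3 b v u = - sign3 u v b := by unfold sign3; ring
  have e2 : sign3 v a u = sign3 u v a := by unfold sign3; ring
  have e3 : sign3 a u v = sign3 u v a := by unfold sign3; ring
  have e4 : sign3 u b v = - sign3 u v b := by unfold sign3; ring
  have e5 : sign3 b a v = - sign3 a b v := by unfold sign3; ring
  rcases lt_or_gt_of_ne hnu with hlu | hgu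
  · rcases lt_or_gt_of_ne hnv with hlv | hgv
    · right
      exact mem_interior_of_sign3_pos hb ha hu (by linarith) (by linarith) (by linarith)
    · exfalso
      set x := sign3 u v a with hx
      set y := sign3 u v b with hy
      set p := sign3 a b u with hp
      set q := sign3 a b v with hq
      have e : x - y = q - p := by rw [hx, hy, hp, hq]; unfold sign3; ring
      have hxy : 0 < x - y := by linarith
      have hm1 : (q / (x - y)) • u + (-p / (x - y)) • v ∈ openSegment ℝ u v :=
        ⟨_, _, by positivity, div_pos (by linarith) hxy,
          by rw [← add_div, e]; rw [div_eq_one_iff_eq] <;> linarith, rfl⟩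
      have hm2 : (-y / (x - y)) • a + (x / (x - y)) • b ∈ openSegment ℝ a b :=
        ⟨_, _, div_pos (by linarith) hxy, by positivity, by field_simp; ring, rfl⟩
      have heq : (q / (x - y)) • u + (-p / (x - y)) • v
          = (-y / (x - y)) • a + (x / (x - y)) • b := by
        refine Prod.ext ?_ ?_
        · simp; field_simp; rw [hx, hy, hp, hq]; unfold sign3; ring
        · simp; field_simp; rw [hx, hy, hp, hq]; unfold sign3; ring
      have : (q / (x - y)) • u + (-p / (x - y)) • v ∈
        openSegment ℝ u v ∩ openSegment ℝ a b := ⟨hm1, heq ▸ hm2⟩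
      rw [hd] at this
      exact this
  · left
    exact mem_interior_of_sign3_pos ha hb hv hgu (by linarith) (by linarith)

/-! ### Edges of paths -/

lemma pathEdges_cons_cons (a b : Pt) (l : List Pt) :
    pathEdges (a :: b :: l) = (a, b) :: pathEdges (b :: l) := rfl

lemma mem_of_mem_pathEdges {l : List Pt} {e : Pt × Pt} (he : e ∈ pathEdges l) :
    e.1 ∈ l ∧ e.2 ∈ l :=
  ⟨(List.of_mem_zip he).1, List.mem_of_mem_tail (List.of_mem_zip he).2⟩

lemma exists_pathEdge_of_mixed (P : Pt → Prop) {l : List Pt} {a b : Pt} (ha : a ∈ l)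
    (hb : b ∈ l) (hPa : P a) (hPb : ¬ P b) :
    ∃ e ∈ pathEdges l, (P e.1 ∧ ¬ P e.2) ∨ (¬ P e.1 ∧ P e.2) := by
  induction l generalizing a b with
  | nil => simp at ha
  | cons x t ih =>
    cases t with
    | nil => simp at ha hb; subst ha hb; exact absurd hPa hPb
    | cons y t =>
      rw [pathEdges_cons_cons]
      by_cases hmix : (P x ↔ P y)
      · obtain ⟨a', ha', hPa'⟩ : ∃ a' ∈ y :: t, P a' := by
          rcases List.mem_cons.mp ha with rfl | h
          · exact ⟨y, by simp, hmix.mp hPa⟩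
          · exact ⟨a, h, hPa⟩
        obtain ⟨b', hb', hPb'⟩ : ∃ b' ∈ y :: t, ¬ P b' := by
          rcases List.mem_cons.mp hb with rfl | h
          · exact ⟨y, by simp, fun h => hPb (hmix.mpr h)⟩
          · exact ⟨b, h, hPb⟩
        obtain ⟨e, he, h⟩ := ih ha' hb' hPa' hPb'
        exact ⟨e, List.mem_cons_of_mem _ he, h⟩
      · exact ⟨(x, y), by simp, by tauto⟩

/-- A path whose edges sweep through consecutive intervals of values of `θ` is plane. -/
lemma noncrossing_of_sweep (θ : Pt → ℝ) (p : Pt) (l : List Pt)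
    (h : (p :: l).IsChain fun p q => θ p < θ q ∧
      ∀ x ∈ openSegment ℝ p q, θ p < θ x ∧ θ x < θ q) :
    NonCrossing (pathEdges (p :: l)) ∧
      ∀ e ∈ pathEdges (p :: l), ∀ x ∈ openSegment ℝ e.1 e.2, θ p < θ x := by
  induction l generalizing p with
  | nil => simp [pathEdges, NonCrossing]
  | cons q l ih =>
    rw [List.isChain_cons_cons] at h
    obtain ⟨⟨hpq, hx⟩, hc⟩ := h
    obtain ⟨ih1, ih2⟩ := ih q hc
    rw [pathEdges_cons_cons]
    refine ⟨List.pairwise_cons.mpr ⟨fun e he => ?_, ih1⟩, ?_⟩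
    · rw [Set.eq_empty_iff_forall_notMem]
      rintro x ⟨h1, h2⟩
      exact lt_asymm (hx x h1).2 (ih2 e he x h2)
    · intro e he x h
      rcases List.mem_cons.mp he with rfl | he
      · exact (hx x h).1
      · exact hpq.trans (ih2 e he x h)

lemma exists_sorted_list (T : Finset Pt) (θ : Pt → ℝ) (hinj : Set.InjOn θ T) :
    ∃ l : List Pt, l.Nodup ∧ l.toFinset = T ∧ l.Pairwise fun p q => θ p < θ q := by
  let r : Pt → Pt → Prop := fun p q => θ p ≤ θ q
  have : Std.Total r := ⟨fun p q => le_total (θ p) (θ q)⟩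
  have : IsTrans Pt r := ⟨fun _ _ _ h1 h2 => le_trans (α := ℝ) h1 h2⟩
  have hperm := List.perm_insertionSort r T.toList
  have hnd : (T.toList.insertionSort r).Nodup := hperm.nodup_iff.mpr T.nodup_toList
  have hmem : ∀ p, p ∈ T.toList.insertionSort r ↔ p ∈ T := fun p => by
    rw [hperm.mem_iff, Finset.mem_toList]
  refine ⟨T.toList.insertionSort r, hnd, by ext p; simp [hmem], ?_⟩
  refine ((List.pairwise_insertionSort r T.toList).and hnd).imp_of_mem ?_
  intro p q hp hq hpq
  exact lt_of_le_of_ne hpq.1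
    fun he => hpq.2 (hinj ((hmem p).mp hp) ((hmem q).mp hq) he)

lemma isChain_of_sorted {θ : Pt → ℝ} {l : List Pt} (h : l.Pairwise fun p q => θ p < θ q) :
    l.IsChain fun p q => p ∈ l ∧ q ∈ l ∧ θ p < θ q ∧ ∀ r ∈ l, θ r ≤ θ p ∨ θ q ≤ θ r := by
  rw [List.isChain_iff_getElem]
  rw [List.pairwise_iff_getElem] at h
  intro i hi
  refine ⟨List.getElem_mem _, List.getElem_mem _, h _ _ _ _ (Nat.lt_succ_self i), ?_⟩
  intro r hr
  obtain ⟨j, hj, rfl⟩ := List.mem_iff_getElem.mp hr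
  rcases lt_trichotomy j i with hlt | rfl | hlt
  · exact Or.inl (h _ _ _ _ hlt).le
  · exact Or.inl le_rfl
  · rcases Nat.lt_or_eq_of_le (Nat.succ_le_of_lt hlt) with hlt | heq
    · exact Or.inr (h _ _ _ _ hlt).le
    · subst heq; exact Or.inr le_rfl

/-! ### Arguments of complex numbers -/

lemma cross_eq_sin (z w : ℂ) :
    z.im * w.re - z.re * w.im = ‖z‖ * ‖w‖ * Real.sin (z.arg - w.arg) := by
  rw [Real.sin_sub]
  nth_rw 1 [← Complex.norm_mul_sin_arg z, ← Complex.norm_mul_cos_arg w,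
    ← Complex.norm_mul_cos_arg z, ← Complex.norm_mul_sin_arg w]
  ring

lemma sin_pos_of_cross_pos {z w : ℂ} (h : 0 < z.im * w.re - z.re * w.im) :
    0 < Real.sin (z.arg - w.arg) := by
  rw [cross_eq_sin] at h
  exact (pos_iff_pos_of_mul_pos h).mp
    (lt_of_le_of_ne (by positivity) fun h0 => by rw [← h0] at h; simp at h)

lemma pos_or_lt_neg_pi_of_sin_pos {x : ℝ} (h2 : x < 2 * Real.pi)
    (h : 0 < Real.sin x) : (0 < x ∧ x < Real.pi) ∨ x < -Real.pi := by
  by_contra! hn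
  obtain ⟨hn1, hn2⟩ := hn
  rcases le_or_gt x 0 with h0 | h0
  · exact absurd h (not_lt.mpr (Real.sin_nonpos_of_nonpos_of_neg_pi_le h0 hn2))
  · have h3 := hn1 h0
    have := Real.sin_nonneg_of_nonneg_of_le_pi (x := x - Real.pi) (by linarith) (by linarith)
    rw [Real.sin_sub_pi] at this
    linarith

lemma arg_between {z w : ℂ} (hlt : w.arg < z.arg) (hcross : 0 < z.im * w.re - z.re * w.im)
    {s t : ℝ} (hs : 0 < s) (ht : 0 < t) :
    w.arg < (s * z + t * w).arg ∧ (s * z + t * w).arg < z.arg := by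
  set y : ℂ := s * z + t * w with hy
  have hre : y.re = s * z.re + t * w.re := by simp [hy]
  have him : y.im = s * z.im + t * w.im := by simp [hy]
  have h1 : 0 < z.im * y.re - z.re * y.im := by rw [hre, him]; nlinarith
  have h2 : 0 < y.im * w.re - y.re * w.im := by rw [hre, him]; nlinarith
  have hz := Complex.neg_pi_lt_arg z
  have hz' := Complex.arg_le_pi z
  have hw := Complex.neg_pi_lt_arg w
  have hw' := Complex.arg_le_pi w
  have hy1 := Complex.neg_pi_lt_arg y
  have hy2 := Complex.arg_le_pi y
  have k1 := pos_or_lt_neg_pi_of_sin_pos (by linarith) (sin_pos_of_cross_pos h1)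
  have k2 := pos_or_lt_neg_pi_of_sin_pos (by linarith) (sin_pos_of_cross_pos h2)
  rcases k1 with ⟨k1, _⟩ | k1
  · rcases k2 with ⟨k2, _⟩ | k2
    · constructor <;> linarith
    · linarith
  · rcases k2 with ⟨k2, _⟩ | k2 <;> linarith

lemma arg_add_pi_le_of_cross_nonpos {z w : ℂ} (hz : z ≠ 0) (hw : w ≠ 0) (hlt : w.arg < z.arg)
    (hcross : z.im * w.re - z.re * w.im ≤ 0) : w.arg + Real.pi ≤ z.arg := by
  by_contra! hn
  have hsin := Real.sin_pos_of_pos_of_lt_pi (x := z.arg - w.arg) (by linarith) (by linarith)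
  rw [cross_eq_sin] at hcross
  have : 0 < ‖z‖ * ‖w‖ * Real.sin (z.arg - w.arg) := by positivity
  linarith

lemma cross_nonneg_of_gap {z w r : ℂ} (hgap : w.arg + Real.pi ≤ z.arg)
    (hr : z.arg ≤ r.arg ∨ r.arg ≤ w.arg) : 0 ≤ r.im * z.re - r.re * z.im := by
  rw [cross_eq_sin]
  refine mul_nonneg (by positivity) ?_
  have := Complex.neg_pi_lt_arg w
  have := Complex.neg_pi_lt_arg r
  have := Complex.arg_le_pi r
  have := Complex.arg_le_pi z
  rcases hr with hr | hr
  · exact Real.sin_nonneg_of_nonneg_of_le_pi (by linarith) (by linarith)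
  · rw [← Real.sin_add_two_pi]
    exact Real.sin_nonneg_of_nonneg_of_le_pi (by linarith) (by linarith)

/-! ### The radial order around a point -/

/-- The position of `p` relative to `c`, as a complex number in coordinates in which
`w` lies on the negative real axis. -/
def relPos (c w p : Pt) : ℂ :=
  ⟨-((p.1 - c.1) * (w.1 - c.1) + (p.2 - c.2) * (w.2 - c.2)), -sign3 c w p⟩

/-- The (clockwise) angle of `p` seen from `c`, which is minimal at `w`. -/
def sweepAngle (c w p : Pt) : ℝ := -(relPos c w p).arg

lemma sq_dist_pos {c w : Pt} (h : c ≠ w) : 0 < (w.1 - c.1) ^ 2 + (w.2 - c.2) ^ 2 := by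
  by_contra hn
  exact h (Prod.ext (by nlinarith [sq_nonneg (w.1 - c.1), sq_nonneg (w.2 - c.2)])
    (by nlinarith [sq_nonneg (w.1 - c.1), sq_nonneg (w.2 - c.2)]))

lemma relPos_cross (c w p q : Pt) :
    (relPos c w p).im * (relPos c w q).re - (relPos c w p).re * (relPos c w q).im
      = ((w.1 - c.1) ^ 2 + (w.2 - c.2) ^ 2) * sign3 c q p := by
  simp only [relPos, sign3]; ring

lemma relPos_convexComb (c w p q : Pt) {s t : ℝ} (hst : s + t = 1) :
    relPos c w (s • p + t • q) = s * relPos c w p + t * relPos c w q := by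
  obtain rfl : s = 1 - t := by linarith
  apply Complex.ext
  · simp [relPos]; ring
  · simp [relPos, sign3]; ring

lemma relPos_self (c w : Pt) : relPos c w c = 0 := by
  apply Complex.ext <;> simp [relPos, sign3]

lemma relPos_ne_zero {c w p : Pt} (hcw : c ≠ w) (hp : c ≠ p) : relPos c w p ≠ 0 := by
  intro h
  have h1 := congrArg Complex.re h
  have h2 := congrArg Complex.im h
  simp only [relPos, sign3, Complex.zero_re, Complex.zero_im] at h1 h2
  have := mul_pos (sq_dist_pos hcw) (sq_dist_pos hp)
  nlinarith

lemma sweepAngle_openSegment_center {c w p x : Pt} (hx : x ∈ openSegment ℝ c p) :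
    sweepAngle c w x = sweepAngle c w p := by
  obtain ⟨s, t, hs, ht, hst, rfl⟩ := hx
  rw [sweepAngle, sweepAngle, relPos_convexComb _ _ _ _ hst, relPos_self, mul_zero, zero_add,
    Complex.arg_real_mul _ ht]

lemma sweepAngle_openSegment {c w p q x : Pt} (hcw : c ≠ w)
    (hlt : sweepAngle c w p < sweepAngle c w q) (hpos : 0 < sign3 c q p)
    (hx : x ∈ openSegment ℝ p q) :
    sweepAngle c w p < sweepAngle c w x ∧ sweepAngle c w x < sweepAngle c w q := by
  obtain ⟨s, t, hs, ht, hst, rfl⟩ := hx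
  unfold sweepAngle at *
  rw [relPos_convexComb _ _ _ _ hst]
  have := arg_between (z := relPos c w p) (w := relPos c w q) (by linarith)
    (by rw [relPos_cross]; exact mul_pos (sq_dist_pos hcw) hpos) hs ht
  constructor <;> linarith

lemma sweepAngle_base {c w : Pt} (hcw : c ≠ w) : sweepAngle c w w = -Real.pi := by
  rw [sweepAngle, neg_inj, Complex.arg_eq_pi_iff]
  have := sq_dist_pos hcw
  simp only [relPos, sign3]
  constructor <;> nlinarith

lemma sweepAngle_base_le {c w : Pt} (hcw : c ≠ w) (p : Pt) :
    sweepAngle c w w ≤ sweepAngle c w p := by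
  rw [sweepAngle_base hcw]
  exact neg_le_neg (Complex.arg_le_pi _)

lemma sweepAngle_injOn {S : Finset Pt} (hgp : GenPos S) {c w : Pt} (hc : c ∈ S) (hcw : c ≠ w) :
    Set.InjOn (sweepAngle c w) (S.erase c : Finset Pt) := by
  intro p hp q hq h
  simp only [Finset.coe_erase, Set.mem_sdiff, Finset.mem_coe, Set.mem_singleton_iff] at hp hq
  by_contra hpq
  have h0 := relPos_cross c w p q
  unfold sweepAngle at h
  rw [cross_eq_sin, neg_inj.mp h, sub_self, Real.sin_zero, mul_zero] at h0
  rcases mul_eq_zero.mp h0.symm with h1 | h1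
  · exact (sq_dist_pos hcw).ne' h1
  · exact sign3_ne_zero hgp hc hq.1 hp.1 (Ne.symm hq.2) (Ne.symm hp.2) (Ne.symm hpq) h1

/-- Radially consecutive points around an interior point span an angle less than `π`. -/
lemma sign3_pos_of_consecutive {S : Finset Pt} {c w p q : Pt}
    (hcw : c ≠ w) (hp : p ∈ S.erase c) (hq : q ∈ S.erase c)
    (hlt : sweepAngle c w p < sweepAngle c w q)
    (hbetween : ∀ r ∈ S.erase c,
      sweepAngle c w r ≤ sweepAngle c w p ∨ sweepAngle c w q ≤ sweepAngle c w r)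
    (hint : c ∈ interior (convexHull ℝ (S : Set Pt))) : 0 < sign3 c q p := by
  by_contra! hn
  have hd := sq_dist_pos hcw
  have hcp := Ne.symm (Finset.ne_of_mem_erase hp)
  have hcq := Ne.symm (Finset.ne_of_mem_erase hq)
  unfold sweepAngle at hlt hbetween
  have hgap := arg_add_pi_le_of_cross_nonpos (relPos_ne_zero hcw hcp) (relPos_ne_zero hcw hcq)
    (by linarith) (by rw [relPos_cross]; exact mul_nonpos_of_nonneg_of_nonpos hd.le hn)
  refine notMem_interior_of_sign3_nonneg hcp (fun r hr => ?_) (by simp [sign3]) hint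
  by_cases hrc : r = c
  · subst hrc; simp [sign3]
  · have := cross_nonneg_of_gap (r := relPos c w r) hgap
      ((hbetween r (Finset.mem_erase.mpr ⟨hrc, hr⟩)).imp (by intro h; linarith)
        (by intro h; linarith))
    rw [relPos_cross] at this
    exact nonneg_of_mul_nonneg_right this hd

lemma HullEdge.sign3_pos_of_sweepAngle_lt {S : Finset Pt} (hgp : GenPos S) {c w p q : Pt}
    (hcw : c ≠ w) (h : HullEdge S c w) (hp : p ∈ (S.erase c).erase w)
    (hq : q ∈ (S.erase c).erase w) (hlt : sweepAngle c w p < sweepAngle c w q) :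
    0 < sign3 c q p := by
  have hc := h.1
  have hw := h.2.1
  simp only [Finset.mem_erase] at hp hq
  by_contra! hn
  have hd := sq_dist_pos hcw
  unfold sweepAngle at hlt
  have hgap := arg_add_pi_le_of_cross_nonpos (relPos_ne_zero hcw (Ne.symm hp.2.1))
    (relPos_ne_zero hcw (Ne.symm hq.2.1))
    (by linarith) (by rw [relPos_cross]; exact mul_nonpos_of_nonneg_of_nonpos hd.le hn)
  have hnp := sign3_ne_zero hgp hc hw hp.2.2 hcw (Ne.symm hp.2.1) (Ne.symm hp.1)
  have hnq := sign3_ne_zero hgp hc hw hq.2.2 hcw (Ne.symm hq.2.1) (Ne.symm hq.1)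
  have hp0 : 0 ≤ (relPos c w p).arg := by
    linarith [Complex.neg_pi_lt_arg (relPos c w q)]
  have hq0 : (relPos c w q).arg ≤ 0 := by
    linarith [Complex.arg_le_pi (relPos c w p)]
  rw [Complex.arg_nonneg_iff] at hp0
  have hq1 : (relPos c w q).arg ≠ 0 := by
    intro h0
    rw [Complex.arg_eq_zero_iff] at h0
    have := h0.2
    simp only [relPos] at this
    exact hnq (by linarith)
  have hq2 := Complex.arg_neg_iff.mp (lt_of_le_of_ne hq0 hq1)
  simp only [relPos] at hp0 hq2
  exact h.not_separates hgp hq.2.2 hp.2.2 (by linarith)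
    (lt_of_le_of_ne (by linarith) hnp)

/-! ### Radial paths -/

lemma exists_planePath_of_interior_first {S : Finset Pt} (hgp : GenPos S) {c w : Pt}
    (hc : c ∈ S) (hw : w ∈ S) (hcw : c ≠ w)
    (hint : c ∈ interior (convexHull ℝ (S : Set Pt))) :
    ∃ rest, IsPlanePath S (c :: w :: rest) := by
  have hinj := sweepAngle_injOn hgp hc hcw
  obtain ⟨l, hnd, hl, hs⟩ := exists_sorted_list ((S.erase c).erase w) (sweepAngle c w)
    (hinj.mono (by simp))
  have hmem : ∀ p, p ∈ l ↔ p ≠ w ∧ p ≠ c ∧ p ∈ S := fun p => by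
    rw [← List.mem_toFinset, hl]; simp
  have hmem' : ∀ p, p ∈ w :: l ↔ p ∈ S.erase c := fun p => by
    rw [List.mem_cons, hmem, Finset.mem_erase]
    by_cases hpw : p = w
    · subst hpw; simp [hw, hcw.symm]
    · simp [hpw]
  have hbase : ∀ p ∈ l, sweepAngle c w w < sweepAngle c w p := fun p hp =>
    lt_of_le_of_ne (sweepAngle_base_le hcw p) fun he =>
      ((hmem p).mp hp).1 (hinj ((hmem' p).mp (List.mem_cons_of_mem _ hp))
        ((hmem' w).mp List.mem_cons_self) he.symm)
  have hs' : (w :: l).Pairwise fun p q => sweepAngle c w p < sweepAngle c w q :=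
    List.pairwise_cons.mpr ⟨hbase, hs⟩
  obtain ⟨hn1, hn2⟩ := noncrossing_of_sweep (sweepAngle c w) w l
    ((isChain_of_sorted hs').imp fun p q ⟨hp, hq, hlt, hb⟩ => ⟨hlt, fun x hx =>
      sweepAngle_openSegment hcw hlt (sign3_pos_of_consecutive hcw ((hmem' p).mp hp)
        ((hmem' q).mp hq) hlt (fun r hr => hb r ((hmem' r).mpr hr)) hint) hx⟩)
  refine ⟨l, ?_, ?_, ?_⟩
  · simp only [List.nodup_cons, List.mem_cons, hmem]
    exact ⟨by simp [hcw], by simp, hnd⟩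
  · ext p
    rw [List.mem_toFinset, List.mem_cons, hmem', Finset.mem_erase]
    by_cases hpc : p = c
    · subst hpc; simp [hc]
    · simp [hpc]
  · rw [pathEdges_cons_cons]
    refine List.pairwise_cons.mpr ⟨fun e he => ?_, hn1⟩
    rw [Set.eq_empty_iff_forall_notMem]
    rintro x ⟨h1, h2⟩
    have := hn2 e he x h2
    rw [sweepAngle_openSegment_center h1] at this
    exact lt_irrefl _ this

lemma exists_planePath_of_center_second {S : Finset Pt} (hgp : GenPos S) {c w : Pt}
    (hc : c ∈ S) (hw : w ∈ S) (hcw : c ≠ w)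
    (h : c ∈ interior (convexHull ℝ (S : Set Pt)) ∨ HullEdge S c w) :
    ∃ rest, IsPlanePath S (w :: c :: rest) := by
  have hinj := sweepAngle_injOn hgp hc hcw
  obtain ⟨l, hnd, hl, hs⟩ := exists_sorted_list ((S.erase c).erase w) (sweepAngle c w)
    (hinj.mono (by simp))
  have hmem : ∀ p, p ∈ l ↔ p ≠ w ∧ p ≠ c ∧ p ∈ S := fun p => by
    rw [← List.mem_toFinset, hl]; simp
  have hmem1 : ∀ p, p ∈ l → p ∈ S.erase c := fun p hp =>
    Finset.mem_erase.mpr ((hmem p).mp hp).2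
  have hbase : ∀ p ∈ l, sweepAngle c w w < sweepAngle c w p := fun p hp =>
    lt_of_le_of_ne (sweepAngle_base_le hcw p) fun he =>
      ((hmem p).mp hp).1 (hinj (hmem1 p hp)
        (Finset.mem_erase.mpr ⟨hcw.symm, hw⟩) he.symm)
  have hchain : l.IsChain fun p q => sweepAngle c w p < sweepAngle c w q ∧
      ∀ x ∈ openSegment ℝ p q,
        sweepAngle c w p < sweepAngle c w x ∧ sweepAngle c w x < sweepAngle c w q := by
    refine (isChain_of_sorted hs).imp fun p q ⟨hp, hq, hlt, hb⟩ => ⟨hlt, fun x hx =>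
      sweepAngle_openSegment hcw hlt ?_ hx⟩
    rcases h with hint | hedge
    · refine sign3_pos_of_consecutive hcw (hmem1 p hp) (hmem1 q hq) hlt (fun r hr => ?_) hint
      by_cases hrw : r = w
      · subst hrw; exact Or.inl (hbase p hp).le
      · exact hb r ((hmem r).mpr ⟨hrw, Finset.mem_erase.mp hr⟩)
    · exact hedge.sign3_pos_of_sweepAngle_lt hgp hcw
        (by simpa using (hmem p).mp hp) (by simpa using (hmem q).mp hq) hlt
  refine ⟨l, ?_, ?_, ?_⟩
  · simp only [List.nodup_cons, List.mem_cons, hmem]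
    exact ⟨by simp [hcw.symm], by simp, hnd⟩
  · ext p
    rw [List.mem_toFinset, List.mem_cons, List.mem_cons, hmem]
    by_cases hpc : p = c
    · subst hpc; simp [hc]
    · by_cases hpw : p = w
      · subst hpw; simp [hw]
      · simp [hpc, hpw]
  · rw [pathEdges_cons_cons]
    cases l with
    | nil => simp [pathEdges, NonCrossing]
    | cons p t =>
      obtain ⟨hn1, hn2⟩ := noncrossing_of_sweep (sweepAngle c w) p t hchain
      have hwp := hbase p List.mem_cons_self
      rw [pathEdges_cons_cons]
      refine List.pairwise_cons.mpr ⟨fun e he => ?_, List.pairwise_cons.mpr ⟨fun e he => ?_, hn1⟩⟩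
      · rw [Set.eq_empty_iff_forall_notMem]
        rintro x ⟨h1, h2⟩
        rw [openSegment_symm] at h1
        have k1 := sweepAngle_openSegment_center (w := w) h1
        rcases List.mem_cons.mp he with rfl | he
        · have k2 := sweepAngle_openSegment_center (w := w) h2
          exact hwp.ne (k1.symm.trans k2)
        · have k2 := hn2 e he x h2
          linarith
      · rw [Set.eq_empty_iff_forall_notMem]
        rintro x ⟨h1, h2⟩
        have k1 := sweepAngle_openSegment_center (w := w) h1
        have k2 := hn2 e he x h2
        exact k2.ne' k1

lemma HullEdge.symm {S : Finset Pt} {u v : Pt} (h : HullEdge S u v) : HullEdge S v u :=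
  ⟨h.2.1, h.1, h.2.2.1.symm, by rw [segment_symm]; exact h.2.2.2⟩

lemma IsPlanePath.interior_or_hullEdge {S : Finset Pt} (hgp : GenPos S) {u v : Pt}
    {rest : List Pt} (h : IsPlanePath S (u :: v :: rest)) :
    u ∈ interior (convexHull ℝ (S : Set Pt)) ∨
      v ∈ interior (convexHull ℝ (S : Set Pt)) ∨ HullEdge S u v := by
  obtain ⟨hnd, hS, hnc⟩ := h
  have hmem : ∀ p, p ∈ S ↔ p = u ∨ p = v ∨ p ∈ rest := fun p => by
    rw [← hS]; simp
  have hu : u ∈ S := by simp [hmem]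
  have hv : v ∈ S := by simp [hmem]
  simp only [List.nodup_cons, List.mem_cons, not_or] at hnd
  obtain ⟨⟨huv, hur⟩, hvr, -⟩ := hnd
  have huu : sign3 u v u = 0 := by simp [sign3]
  have hvv : sign3 u v v = 0 := by simp [sign3]; ring
  have huu' : sign3 v u u = 0 := by simp [sign3]; ring
  have hvv' : sign3 v u v = 0 := by simp [sign3]
  by_cases hpos : ∀ r ∈ S, 0 ≤ sign3 u v r
  · exact Or.inr (Or.inr (hullEdge_of_sign3_nonneg hu hv huv huv hpos huu hvv))
  by_cases hneg : ∀ r ∈ S, sign3 u v r ≤ 0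
  · refine Or.inr (Or.inr (hullEdge_of_sign3_nonneg hu hv huv (Ne.symm huv)
      (fun r hr => ?_) huu' hvv'))
    have : sign3 v u r = - sign3 u v r := by unfold sign3; ring
    linarith [hneg r hr]
  push Not at hpos hneg
  obtain ⟨b, hb, hbn⟩ := hpos
  obtain ⟨a, ha, hap⟩ := hneg
  have hrest : ∀ p ∈ S, sign3 u v p ≠ 0 → p ∈ rest := by
    intro p hp hne
    rcases (hmem p).mp hp with rfl | rfl | h
    · exact absurd huu hne
    · exact absurd hvv hne
    · exact h
  obtain ⟨e, he, hmix⟩ := exists_pathEdge_of_mixed (fun p => 0 < sign3 u v p)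
    (hrest a ha hap.ne') (hrest b hb hbn.ne) hap hbn.not_gt
  obtain ⟨he1, he2⟩ := mem_of_mem_pathEdges he
  have hd : openSegment ℝ u v ∩ openSegment ℝ e.1 e.2 = ∅ := by
    rw [pathEdges_cons_cons] at hnc
    refine (List.pairwise_cons.mp hnc).1 e ?_
    cases rest with
    | nil => simp at he1
    | cons p t => rw [pathEdges_cons_cons]; exact List.mem_cons_of_mem _ he
  have hneg_of : ∀ p ∈ rest, ¬ 0 < sign3 u v p → sign3 u v p < 0 := by
    intro p hp hn
    refine lt_of_le_of_ne (not_lt.mp hn) (sign3_ne_zero hgp hu hv (by simp [hmem, hp]) huv ?_ ?_)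
    · rintro rfl; exact hur hp
    · rintro rfl; exact hvr hp
  have hS1 : e.1 ∈ S := by simp [hmem, he1]
  have hS2 : e.2 ∈ S := by simp [hmem, he2]
  rw [← or_assoc]
  left
  rcases hmix with ⟨h1, h2⟩ | ⟨h1, h2⟩
  · exact mem_interior_or_of_separates hgp hu hv hS1 hS2 h1 (hneg_of _ he2 h2) hd
  · exact mem_interior_or_of_separates hgp hu hv hS2 hS1 h2 (hneg_of _ he1 h1)
      (by rw [openSegment_symm ℝ e.2 e.1]; exact hd)

/-- Characterization of viable starting edges: a plane spanning path of `S` starts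
with `u, v` iff `u` or `v` is strictly inside the convex hull, or `u` and `v` are
consecutive along the convex hull boundary. -/
theorem stmt_2 (S : Finset Pt) (hgp : GenPos S) (hcard : 3 ≤ S.card)
    (u v : Pt) (hu : u ∈ S) (hv : v ∈ S) (huv : u ≠ v) :
    (∃ rest, IsPlanePath S (u :: v :: rest)) ↔
      (u ∈ interior (convexHull ℝ (S : Set Pt)) ∨
       v ∈ interior (convexHull ℝ (S : Set Pt)) ∨ HullEdge S u v) := by
  constructor
  · rintro ⟨rest, h⟩
    exact h.interior_or_hullEdge hgp
  · rintro (h | h | h)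
    · exact exists_planePath_of_interior_first hgp hu hv huv h
    · exact exists_planePath_of_center_second hgp hv hu huv.symm (Or.inl h)
    · exact exists_planePath_of_center_second hgp hv hu huv.symm (Or.inr h.symm)
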